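/- Let A be an n×n real Hurwitz matrix and C a k×n real matrix. Then there exist n×n matrices E, F with F = EA and a symmetric positive definite Q such that for every data point z̃ = (ṽ, x̃, ũ, ỹ) with zero continuous-time equation errors for the linear model (i.e. F x̃ + L ũ = E ṽ and C x̃ + H ũ = ỹ, with model output matrices G = C, H = D and input matrix L = EB), both the continuous-time global RIE and its convex upper bound vanish: 𝓔_Q(z̃) = 𝓔̂_Q(z̃) = 0. Equivalently, with the choices E = (I−A)ᵀR, F = (I−A)ᵀRA, Q = ((I−A)ᵀR(I−A))⁻¹ for R ≻ 0 solving AᵀR + RA ≺ −CᵀC, the matrix (E+F)ᵀQ(E+F) + Q⁻¹ − (E−F)ᵀ − (E−F) + 2CᵀC is negative definite, so the supremum over Δ of the corresponding homogeneous quadratic form is 0. -/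

import Mathlib

open Matrix

/-- `|a|²_Q = aᵀ Q a`. -/
noncomputable def quadForm {n : ℕ} (Q : Matrix (Fin n) (Fin n) ℝ) (a : Fin n → ℝ) : ℝ :=
  a ⬝ᵥ Q.mulVec a

open scoped Matrix.Norms.L2Operator in
lemma aux_bound {p n : ℕ} (K : Matrix (Fin p) (Fin n) ℂ) (x : Fin n → ℂ) :
    ∑ i, ‖(K *ᵥ x) i‖ ^ 2 ≤ ‖K‖ ^ 2 * ∑ i, ‖x i‖ ^ 2 := by
  have h := Matrix.l2_opNorm_mulVec K (WithLp.toLp 2 x)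
  have h2 := pow_le_pow_left₀ (norm_nonneg _) h 2
  rw [mul_pow, EuclideanSpace.norm_sq_eq, EuclideanSpace.norm_sq_eq] at h2
  simpa using h2

open scoped Matrix.Norms.L2Operator in
lemma aux_bound_real {p n : ℕ} (K : Matrix (Fin p) (Fin n) ℝ) (x : Fin n → ℝ) :
    (K *ᵥ x) ⬝ᵥ (K *ᵥ x) ≤ ‖K.map Complex.ofReal‖ ^ 2 * (x ⬝ᵥ x) := by
  have h := aux_bound (K.map Complex.ofReal) (fun i => (x i : ℂ))
  have e : ∀ i, (K.map Complex.ofReal *ᵥ (fun i => (x i : ℂ))) i = ((K *ᵥ x) i : ℝ) := by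
    intro i
    simp [Matrix.mulVec, dotProduct]
  simp only [e, Complex.norm_real, Real.norm_eq_abs, sq_abs] at h
  simpa [dotProduct, ← sq] using h

open scoped Matrix.Norms.L2Operator in
lemma aux_gelfand {n : ℕ} [NeZero n] (S : Matrix (Fin n) (Fin n) ℂ)
    (hS : ∀ z ∈ spectrum ℂ S, ‖z‖ < 1) : ∃ k : ℕ, 1 ≤ k ∧ ‖S ^ k‖ < 1 := by
  have h1 : spectralRadius ℂ S < ((1 : NNReal) : ENNReal) :=
    spectrum.spectralRadius_lt_of_forall_lt S (fun z hz => by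
      exact_mod_cast hS z hz)
  have h2 := spectrum.pow_nnnorm_pow_one_div_tendsto_nhds_spectralRadius S
  have h3 := (h2.eventually_lt_const h1).and (Filter.eventually_ge_atTop 1)
  obtain ⟨k, hk, hk1⟩ := h3.exists
  refine ⟨k, hk1, ?_⟩
  by_contra hcon
  push Not at hcon
  have : (1 : ENNReal) ≤ (‖S ^ k‖₊ : ENNReal) := by
    exact_mod_cast hcon
  have := ENNReal.one_le_rpow this (z := 1 / (k:ℝ)) (by positivity)
  simp at hk this
  exact absurd hk (not_lt.mpr this)

lemma aux_cayley {n : ℕ} (A M N S : Matrix (Fin n) (Fin n) ℂ)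
    (hA : ∀ μ : ℂ, μ ∈ spectrum ℂ A → μ.re < 0)
    (hM : M = 1 - A) (hN : M * N = 1) (hS : S = (1 + A) * N) (z : ℂ) (hz : z ∈ spectrum ℂ S) :
    ‖z‖ < 1 := by
  by_contra hcon
  push Not at hcon
  apply hz
  rw [spectrum.mem_resolventSet_iff]
  have hNu : IsUnit N := IsUnit.of_mul_eq_one M (mul_eq_one_comm.mp hN)
  have e : algebraMap ℂ (Matrix (Fin n) (Fin n) ℂ) z - S =
      ((z - 1) • (1 : Matrix (Fin n) (Fin n) ℂ) - (z + 1) • A) * N := by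
    have : algebraMap ℂ (Matrix (Fin n) (Fin n) ℂ) z = z • (M * N) := by
      rw [hN, Algebra.algebraMap_eq_smul_one]
    rw [this, hS, ← smul_mul_assoc, ← sub_mul, hM]
    congr 1
    module
  rw [e]
  refine IsUnit.mul ?_ hNu
  by_cases h : z + 1 = 0
  · have hz1 : z = -1 := by linear_combination h
    rw [h, zero_smul, sub_zero, ← Algebra.algebraMap_eq_smul_one]
    refine IsUnit.map _ (IsUnit.mk0 _ ?_)
    rw [hz1]; norm_num
  · have hn : ((z - 1) / (z + 1)) ∉ spectrum ℂ A := by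
      intro hh
      have := hA _ hh
      rw [Complex.div_re, ← add_div] at this
      have hp : 0 < Complex.normSq (z + 1) := Complex.normSq_pos.mpr h
      have h3 : (z - 1).re * (z + 1).re + (z - 1).im * (z + 1).im = ‖z‖ ^ 2 - 1 := by
        rw [Complex.sq_norm, Complex.normSq_apply]; simp; ring
      rw [h3] at this
      have : 0 ≤ (‖z‖ ^ 2 - 1) / Complex.normSq (z + 1) := by
        apply div_nonneg _ hp.le
        nlinarith
      linarith
    rw [spectrum.notMem_iff] at hn
    have e2 : (z - 1) • (1 : Matrix (Fin n) (Fin n) ℂ) - (z + 1) • A =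
        algebraMap ℂ _ (z + 1) * (algebraMap ℂ _ ((z - 1) / (z + 1)) - A) := by
      simp only [Algebra.algebraMap_eq_smul_one, smul_mul_assoc, one_mul, smul_sub, smul_smul]
      congr 2
      field_simp
    rw [e2]
    exact (IsUnit.map _ (IsUnit.mk0 _ h)).mul hn

lemma aux_map_mul {n : ℕ} (A B : Matrix (Fin n) (Fin n) ℝ) :
    (A * B).map Complex.ofReal = A.map Complex.ofReal * B.map Complex.ofReal :=
  Matrix.map_mul (f := Complex.ofRealHom)

lemma aux_map_pow {n : ℕ} (A : Matrix (Fin n) (Fin n) ℝ) (k : ℕ) :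
    (A ^ k).map Complex.ofReal = (A.map Complex.ofReal) ^ k :=
  map_pow (Complex.ofRealHom.mapMatrix) A k

lemma aux_map_one {n : ℕ} :
    (1 : Matrix (Fin n) (Fin n) ℝ).map Complex.ofReal = 1 :=
  map_one (Complex.ofRealHom.mapMatrix)

lemma aux_unit {n : ℕ} (A : Matrix (Fin n) (Fin n) ℝ)
    (hA : ∀ μ : ℂ, μ ∈ spectrum ℂ (A.map Complex.ofReal) → μ.re < 0) :
    IsUnit (1 - A) := by
  have h : (1 : ℂ) ∉ spectrum ℂ (A.map Complex.ofReal) := fun h => by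
    have := hA _ h
    norm_num at this
  rw [spectrum.notMem_iff, map_one, Matrix.isUnit_iff_isUnit_det] at h
  rw [Matrix.isUnit_iff_isUnit_det]
  have e : (1 - A.map Complex.ofReal) = Complex.ofRealHom.mapMatrix (1 - A) := by
    rw [map_sub, map_one]; rfl
  rw [e, ← RingHom.map_det] at h
  simpa using h

lemma aux_tr {p n : ℕ} (K : Matrix (Fin p) (Fin n) ℝ) (x : Fin n → ℝ) (y : Fin p → ℝ) :
    x ⬝ᵥ (Kᵀ *ᵥ y) = (K *ᵥ x) ⬝ᵥ y := by
  rw [Matrix.dotProduct_mulVec, Matrix.vecMul_transpose]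

lemma aux_pos {n : ℕ} (x : Fin n → ℝ) (hx : x ≠ 0) : 0 < x ⬝ᵥ x := by
  have := Matrix.dotProduct_star_self_pos_iff (v := x)
  simpa using this.mpr hx

lemma aux_nonneg {n : ℕ} (x : Fin n → ℝ) : 0 ≤ x ⬝ᵥ x := by
  rw [dotProduct]
  exact Finset.sum_nonneg (fun i _ => mul_self_nonneg _)

open scoped Matrix.Norms.L2Operator in
lemma aux_lyap {n k : ℕ} (A : Matrix (Fin n) (Fin n) ℝ)
    (hA : ∀ μ : ℂ, μ ∈ spectrum ℂ (A.map Complex.ofReal) → μ.re < 0)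
    (C : Matrix (Fin k) (Fin n) ℝ) :
    ∃ R : Matrix (Fin n) (Fin n) ℝ, R.PosDef ∧
      (∀ Δ : Fin n → ℝ, Δ ≠ 0 → Δ ⬝ᵥ (Aᵀ * R + R * A + Cᵀ * C).mulVec Δ < 0) := by
  rcases Nat.eq_zero_or_pos n with rfl | hn
  · exact ⟨1, Matrix.PosDef.one, fun Δ h => absurd (Subsingleton.elim _ _) h⟩
  haveI : NeZero n := ⟨hn.ne'⟩
  have hU := aux_unit A hA
  obtain ⟨N, hMN, hNM⟩ : ∃ N, (1 - A) * N = 1 ∧ N * (1 - A) = 1 := by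
    obtain ⟨u, hu⟩ := hU
    exact ⟨↑u⁻¹, by simp [← hu], by simp [← hu]⟩
  set S := (1 + A) * N with hS
  have hsp := aux_cayley (A.map Complex.ofReal) ((1 - A).map Complex.ofReal)
    (N.map Complex.ofReal) (S.map Complex.ofReal) hA
    (by ext i j; by_cases h : i = j <;> simp [Matrix.one_apply, h])
    (by rw [← aux_map_mul, hMN, aux_map_one])
    (by rw [hS, aux_map_mul]; congr 1
        ext i j; by_cases h : i = j <;> simp [Matrix.one_apply, h])
  obtain ⟨q, hq1, hq⟩ := aux_gelfand _ hsp
  have hb := aux_bound_real (S ^ q)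
  rw [aux_map_pow] at hb
  have hb2 := aux_bound_real (C * N)
  have hcn : 0 ≤ ‖Matrix.map S Complex.ofReal ^ q‖ := norm_nonneg _
  revert hcn hq hb hb2
  generalize ‖Matrix.map S Complex.ofReal ^ q‖ = c
  generalize ‖(C * N).map Complex.ofReal‖ ^ 2 = d'
  intro hq hb hb2 hcn
  set d := |d'| with hd
  have hd0 : 0 ≤ d := abs_nonneg _
  have hc : 0 < 1 - c ^ 2 := by nlinarith
  set R := ∑ j ∈ Finset.range q, (S ^ j)ᵀ * S ^ j with hR
  have hf : ∀ w, w ⬝ᵥ (R *ᵥ w) = ∑ j ∈ Finset.range q, (S ^ j *ᵥ w) ⬝ᵥ (S ^ j *ᵥ w) := by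
    intro w
    rw [hR, Matrix.sum_mulVec, dotProduct_sum]
    refine Finset.sum_congr rfl fun j _ => ?_
    rw [← Matrix.mulVec_mulVec, aux_tr]
  have hRsym : Rᵀ = R := by
    rw [hR, Matrix.transpose_sum]
    simp [Matrix.transpose_mul]
  have hRpos : R.PosDef := by
    refine Matrix.PosDef.of_dotProduct_mulVec_pos (by
      rw [Matrix.IsHermitian, Matrix.conjTranspose_eq_transpose_of_trivial, hRsym]) ?_
    intro x hx
    rw [star_trivial, hf]
    refine Finset.sum_pos' (fun j _ => aux_nonneg _) ⟨0, Finset.mem_range.mpr hq1, ?_⟩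
    simpa using aux_pos x hx
  have htel : ∀ w, (S *ᵥ w) ⬝ᵥ (R *ᵥ (S *ᵥ w)) - w ⬝ᵥ (R *ᵥ w) =
      (S ^ q *ᵥ w) ⬝ᵥ (S ^ q *ᵥ w) - w ⬝ᵥ w := by
    intro w
    rw [hf, hf, ← Finset.sum_sub_distrib]
    have := Finset.sum_range_sub (fun j => (S ^ j *ᵥ w) ⬝ᵥ (S ^ j *ᵥ w)) q
    simpa [Matrix.mulVec_mulVec, ← pow_succ] using this
  have ht : 0 < 2 * (d + 1) / (1 - c ^ 2) := by positivity
  refine ⟨(2 * (d + 1) / (1 - c ^ 2)) • R, hRpos.smul ht, ?_⟩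
  intro x hx
  set w := (1 - A) *ᵥ x with hw
  have hxw : N *ᵥ w = x := by rw [hw, Matrix.mulVec_mulVec, hNM, Matrix.one_mulVec]
  have hw0 : w ≠ 0 := by
    intro h
    rw [h, Matrix.mulVec_zero] at hxw
    exact hx hxw.symm
  have hSw : S *ᵥ w = x + A *ᵥ x := by
    rw [hS, ← Matrix.mulVec_mulVec, hxw, Matrix.add_mulVec, Matrix.one_mulVec]
  have hw' : w = x - A *ᵥ x := by rw [hw, Matrix.sub_mulVec, Matrix.one_mulVec]
  have h1 := htel w
  have h2 := hb w
  have h3 := hb2 w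
  have h4 := aux_pos w hw0
  rw [← Matrix.mulVec_mulVec, hxw] at h3
  have h5 : (x + A *ᵥ x) ⬝ᵥ (R *ᵥ (x + A *ᵥ x)) - (x - A *ᵥ x) ⬝ᵥ (R *ᵥ (x - A *ᵥ x)) =
      2 * (x ⬝ᵥ ((Aᵀ * R + R * A) *ᵥ x)) := by
    simp only [Matrix.add_mulVec, ← Matrix.mulVec_mulVec, aux_tr, dotProduct_add,
      Matrix.mulVec_add, Matrix.mulVec_sub, add_dotProduct, sub_dotProduct, dotProduct_sub]
    ring
  have h6 : x ⬝ᵥ ((Aᵀ * ((2 * (d + 1) / (1 - c ^ 2)) • R) +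
      ((2 * (d + 1) / (1 - c ^ 2)) • R) * A + Cᵀ * C) *ᵥ x) =
      (2 * (d + 1) / (1 - c ^ 2)) * (x ⬝ᵥ ((Aᵀ * R + R * A) *ᵥ x)) + (C *ᵥ x) ⬝ᵥ (C *ᵥ x) := by
    rw [Matrix.mul_smul, Matrix.smul_mul, ← smul_add, Matrix.add_mulVec, Matrix.smul_mulVec,
      dotProduct_add, dotProduct_smul, smul_eq_mul, ← Matrix.mulVec_mulVec, aux_tr]
  rw [h6]
  rw [hSw] at h1
  nth_rewrite 1 [hw'] at h1
  nth_rewrite 1 [hw'] at h1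
  rw [h5] at h1
  have h7 : x ⬝ᵥ ((Aᵀ * R + R * A) *ᵥ x) ≤ -((1 - c ^ 2) / 2 * (w ⬝ᵥ w)) := by linarith
  have h8 := mul_le_mul_of_nonneg_left h7 ht.le
  have h9 : 2 * (d + 1) / (1 - c ^ 2) * -((1 - c ^ 2) / 2 * (w ⬝ᵥ w)) =
    -((d + 1) * (w ⬝ᵥ w)) := by field_simp
  have h10 : d' * (w ⬝ᵥ w) ≤ d * (w ⬝ᵥ w) := mul_le_mul_of_nonneg_right (le_abs_self _) h4.le
  linarith

lemma aux_sup {n : ℕ} (f : (Fin n → ℝ) → ℝ) (h0 : f 0 = 0) (h : ∀ x, x ≠ 0 → f x < 0) :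
    (⨆ x, ((f x : ℝ) : EReal)) = 0 := by
  apply le_antisymm
  · refine iSup_le fun x => ?_
    by_cases hx : x = 0
    · simp [hx, h0]
    · exact_mod_cast (h x hx).le
  · refine le_iSup_of_le 0 ?_
    simp [h0]

section
variable {n k : ℕ} {A R M E F P : Matrix (Fin n) (Fin n) ℝ} {C : Matrix (Fin k) (Fin n) ℝ}

lemma aux_M (hR : R.PosDef)
    (h : ∀ Δ : Fin n → ℝ, Δ ≠ 0 → Δ ⬝ᵥ (Aᵀ * R + R * A + Cᵀ * C).mulVec Δ < 0) :
    IsUnit (1 - A) := by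
  rw [Matrix.isUnit_iff_isUnit_det, isUnit_iff_ne_zero]
  intro hd
  obtain ⟨v, hv, hv0⟩ := Matrix.exists_mulVec_eq_zero_iff.mpr hd
  rw [Matrix.sub_mulVec, Matrix.one_mulVec, sub_eq_zero] at hv0
  have h1 := h v hv
  have h2 := hR.dotProduct_mulVec_pos hv
  rw [star_trivial] at h2
  simp only [Matrix.add_mulVec, ← Matrix.mulVec_mulVec, aux_tr, dotProduct_add, ← hv0] at h1
  have := aux_nonneg (C *ᵥ v)
  linarith

lemma aux_P (hR : R.PosDef) (hM : IsUnit M) : (Mᵀ * R * M).PosDef := by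
  have := hR.conjTranspose_mul_mul_same (B := M) (Matrix.mulVec_injective_iff_isUnit.mpr hM)
  rwa [Matrix.conjTranspose_eq_transpose_of_trivial] at this

lemma aux_sandwich (hR : R.PosDef) (hM : IsUnit M) :
    (Mᵀ * R)ᵀ * (Mᵀ * R * M)⁻¹ * (Mᵀ * R) = R := by
  have hs : Rᵀ = R := by
    have := hR.isHermitian
    rwa [Matrix.IsHermitian, Matrix.conjTranspose_eq_transpose_of_trivial] at this
  have hMd := (Matrix.isUnit_iff_isUnit_det _).mp hM
  have hMt : IsUnit (Mᵀ).det := by rwa [Matrix.det_transpose]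
  have hRd := (Matrix.isUnit_iff_isUnit_det _).mp hR.isUnit
  rw [Matrix.transpose_mul, Matrix.transpose_transpose, hs, Matrix.mul_inv_rev]
  have : (Mᵀ * R)⁻¹ * (Mᵀ * R) = 1 := Matrix.nonsing_inv_mul _ (by
    rw [Matrix.det_mul]; exact hMt.mul hRd)
  rw [mul_assoc, mul_assoc M⁻¹, this, mul_one, mul_assoc, Matrix.mul_nonsing_inv _ hMd, mul_one]

/-- the two quadratic forms -/
lemma aux_q1 (hR : R.PosDef) (hM : IsUnit M) (x : Fin n → ℝ) :
    2 * (((Mᵀ * R) *ᵥ x) ⬝ᵥ ((Mᵀ * R * M)⁻¹ *ᵥ ((Mᵀ * R * A) *ᵥ x))) + (C *ᵥ x) ⬝ᵥ (C *ᵥ x)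
      = x ⬝ᵥ ((Aᵀ * R + R * A + Cᵀ * C) *ᵥ x) := by
  have hs : Rᵀ = R := by
    have := hR.isHermitian
    rwa [Matrix.IsHermitian, Matrix.conjTranspose_eq_transpose_of_trivial] at this
  have h1 : ((Mᵀ * R) *ᵥ x) ⬝ᵥ ((Mᵀ * R * M)⁻¹ *ᵥ ((Mᵀ * R * A) *ᵥ x)) = x ⬝ᵥ (R *ᵥ (A *ᵥ x)) := by
    rw [← aux_tr]
    conv_rhs => rw [← aux_sandwich hR hM]
    simp only [Matrix.mulVec_mulVec, mul_assoc]
  have h2 : (A *ᵥ x) ⬝ᵥ (R *ᵥ x) = x ⬝ᵥ (R *ᵥ (A *ᵥ x)) := by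
    rw [dotProduct_comm, ← aux_tr, hs]
  rw [h1]
  simp only [Matrix.add_mulVec, ← Matrix.mulVec_mulVec, aux_tr, dotProduct_add, h2]
  ring

lemma aux_q2 (hR : R.PosDef) (hM : IsUnit M) (hMA : M = 1 - A) :
    (Mᵀ * R + Mᵀ * R * A)ᵀ * (Mᵀ * R * M)⁻¹ * (Mᵀ * R + Mᵀ * R * A) + Mᵀ * R * M
      - (Mᵀ * R - Mᵀ * R * A)ᵀ - (Mᵀ * R - Mᵀ * R * A) + (2 : ℝ) • (Cᵀ * C)
      = (2 : ℝ) • (Aᵀ * R + R * A + Cᵀ * C) := by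
  have hs : Rᵀ = R := by
    have := hR.isHermitian
    rwa [Matrix.IsHermitian, Matrix.conjTranspose_eq_transpose_of_trivial] at this
  have e1 : Mᵀ * R + Mᵀ * R * A = Mᵀ * R * (1 + A) := by rw [mul_add, mul_one]
  have e2 : Mᵀ * R - Mᵀ * R * A = Mᵀ * R * M := by rw [hMA, mul_sub, mul_one]
  have e3 : (Mᵀ * R * M)ᵀ = Mᵀ * R * M := by
    simp [Matrix.transpose_mul, hs, mul_assoc]
  have e4 : (Mᵀ * R * (1 + A))ᵀ * (Mᵀ * R * M)⁻¹ * (Mᵀ * R * (1 + A)) = (1 + A)ᵀ * R * (1 + A) := by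
    conv_rhs => rw [← aux_sandwich hR hM]
    rw [Matrix.transpose_mul]
    simp only [mul_assoc]
  rw [e1, e2, e3, e4, hMA]
  simp only [Matrix.transpose_add, Matrix.transpose_sub, Matrix.transpose_one, two_smul]
  noncomm_ring

end

/-- Coverage of stable continuous-time linear systems: for a Hurwitz matrix
`A` (system `ẋ = Ax + Bu`, `y = Cx + Du`), there exist `E`, `F = EA` and
`Q ≻ 0` such that at every data point `z̃ = (ṽ, x̃, ũ, ỹ)` with zero equation
errors (model matrices `G = C`, `H = D`, `L = EB`), both the continuous-time
global RIE and its convex upper bound vanish.  Equivalently, for every `R ≻ 0`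
with `AᵀR + RA + CᵀC ≺ 0`, the choices `E = (I−A)ᵀR`, `F = (I−A)ᵀRA`,
`Q = ((I−A)ᵀR(I−A))⁻¹` make
`(E+F)ᵀQ(E+F) + Q⁻¹ − (E−F)ᵀ − (E−F) + 2CᵀC` negative definite, so the
supremum over `Δ` of the corresponding homogeneous quadratic form is `0`. -/
theorem linear_coverage_RIE_zero_ct
    {n m k : ℕ} (A : Matrix (Fin n) (Fin n) ℝ)
    (hA : ∀ μ : ℂ, μ ∈ spectrum ℂ (A.map Complex.ofReal) → μ.re < 0)
    (B : Matrix (Fin n) (Fin m) ℝ) (C : Matrix (Fin k) (Fin n) ℝ)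
    (D : Matrix (Fin k) (Fin m) ℝ) :
    (∃ (E F Q : Matrix (Fin n) (Fin n) ℝ), Q.PosDef ∧ F = E * A ∧
      ∀ (v x : Fin n → ℝ) (u : Fin m → ℝ) (yy : Fin k → ℝ),
        -- zero equation errors at the data point `(v, x, u, yy)`
        F.mulVec x + (E * B).mulVec u - E.mulVec v = 0 →
        C.mulVec x + D.mulVec u - yy = 0 →
        -- the continuous-time global RIE vanishes
        (⨆ Δ : Fin n → ℝ,
          ((2 * ((E.mulVec Δ) ⬝ᵥ Q.mulVec
              (F.mulVec Δ + (F.mulVec x + (E * B).mulVec u - E.mulVec v)))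
            + (C.mulVec Δ + (C.mulVec x + D.mulVec u - yy)) ⬝ᵥ
              (C.mulVec Δ + (C.mulVec x + D.mulVec u - yy)) : ℝ) : EReal)) = 0 ∧
        -- and so does its convex upper bound (with `P = Q⁻¹`)
        (⨆ Δ : Fin n → ℝ,
          (((quadForm Q ((E + F).mulVec Δ + (F.mulVec x + (E * B).mulVec u - E.mulVec v))
              + quadForm Q⁻¹ Δ) / 2
            - Δ ⬝ᵥ ((E - F).mulVec Δ - (F.mulVec x + (E * B).mulVec u - E.mulVec v))
            + (C.mulVec Δ + (C.mulVec x + D.mulVec u - yy)) ⬝ᵥ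
              (C.mulVec Δ + (C.mulVec x + D.mulVec u - yy)) : ℝ) : EReal)) = 0)
    ∧
    -- the explicit construction: for any `R ≻ 0` solving the strict Lyapunov
    -- inequality `AᵀR + RA + CᵀC ≺ 0`
    (∀ R : Matrix (Fin n) (Fin n) ℝ, R.PosDef →
      (∀ Δ : Fin n → ℝ, Δ ≠ 0 → Δ ⬝ᵥ (Aᵀ * R + R * A + Cᵀ * C).mulVec Δ < 0) →
      (∀ Δ : Fin n → ℝ, Δ ≠ 0 →
        Δ ⬝ᵥ ((((1 : Matrix (Fin n) (Fin n) ℝ) - A)ᵀ * R + ((1 - A)ᵀ * R * A))ᵀ *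
              ((1 - A)ᵀ * R * (1 - A))⁻¹ *
              (((1 - A)ᵀ * R) + ((1 - A)ᵀ * R * A))
            + ((1 - A)ᵀ * R * (1 - A))
            - (((1 - A)ᵀ * R) - ((1 - A)ᵀ * R * A))ᵀ
            - (((1 - A)ᵀ * R) - ((1 - A)ᵀ * R * A))
            + (2 : ℝ) • (Cᵀ * C)).mulVec Δ < 0)
      ∧
      (⨆ Δ : Fin n → ℝ,
        ((2 * (((((1 : Matrix (Fin n) (Fin n) ℝ) - A)ᵀ * R).mulVec Δ) ⬝ᵥ
            (((1 - A)ᵀ * R * (1 - A))⁻¹).mulVec (((1 - A)ᵀ * R * A).mulVec Δ))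
          + (C.mulVec Δ) ⬝ᵥ (C.mulVec Δ) : ℝ) : EReal)) = 0) := by
  have expl : ∀ R : Matrix (Fin n) (Fin n) ℝ, R.PosDef →
      (∀ Δ : Fin n → ℝ, Δ ≠ 0 → Δ ⬝ᵥ (Aᵀ * R + R * A + Cᵀ * C).mulVec Δ < 0) →
      (∀ Δ : Fin n → ℝ, Δ ≠ 0 →
        Δ ⬝ᵥ ((((1 : Matrix (Fin n) (Fin n) ℝ) - A)ᵀ * R + ((1 - A)ᵀ * R * A))ᵀ *
              ((1 - A)ᵀ * R * (1 - A))⁻¹ *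
              (((1 - A)ᵀ * R) + ((1 - A)ᵀ * R * A))
            + ((1 - A)ᵀ * R * (1 - A))
            - (((1 - A)ᵀ * R) - ((1 - A)ᵀ * R * A))ᵀ
            - (((1 - A)ᵀ * R) - ((1 - A)ᵀ * R * A))
            + (2 : ℝ) • (Cᵀ * C)).mulVec Δ < 0)
      ∧
      (⨆ Δ : Fin n → ℝ,
        ((2 * (((((1 : Matrix (Fin n) (Fin n) ℝ) - A)ᵀ * R).mulVec Δ) ⬝ᵥ
            (((1 - A)ᵀ * R * (1 - A))⁻¹).mulVec (((1 - A)ᵀ * R * A).mulVec Δ))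
          + (C.mulVec Δ) ⬝ᵥ (C.mulVec Δ) : ℝ) : EReal)) = 0 := by
    intro R hR hneg
    have hM := aux_M hR hneg
    constructor
    · intro x hx
      rw [aux_q2 hR hM rfl, Matrix.smul_mulVec, dotProduct_smul, smul_eq_mul]
      linarith [hneg x hx]
    · apply aux_sup
      · simp
      · intro x hx
        rw [aux_q1 hR hM]
        exact hneg x hx
  refine ⟨?_, expl⟩
  obtain ⟨R, hR, hneg⟩ := aux_lyap A hA C
  obtain ⟨h1, h2⟩ := expl R hR hneg
  have hM := aux_M hR hneg
  have hP := aux_P hR hM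
  refine ⟨(1 - A)ᵀ * R, (1 - A)ᵀ * R * A, ((1 - A)ᵀ * R * (1 - A))⁻¹, hP.inv, rfl, ?_⟩
  intro v x u yy hx hy
  rw [hx, hy]
  simp only [add_zero, sub_zero]
  refine ⟨h2, ?_⟩
  apply aux_sup
  · simp [quadForm]
  · intro Δ hΔ
    have h3 := h1 Δ hΔ
    rw [Matrix.nonsing_inv_nonsing_inv _ ((Matrix.isUnit_iff_isUnit_det _).mp hP.isUnit)]
    unfold quadForm
    generalize (1 - A)ᵀ * R * (1 - A) = P at *
    generalize (1 - A)ᵀ * R * A = F at *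
    generalize (1 - A)ᵀ * R = E at *
    rw [Matrix.add_mulVec, Matrix.sub_mulVec, Matrix.sub_mulVec, Matrix.add_mulVec,
      dotProduct_add, dotProduct_sub, dotProduct_sub, dotProduct_add, aux_tr,
      Matrix.smul_mulVec, dotProduct_smul, smul_eq_mul, ← Matrix.mulVec_mulVec,
      ← Matrix.mulVec_mulVec, aux_tr, ← Matrix.mulVec_mulVec, aux_tr,
      dotProduct_comm ((E - F) *ᵥ Δ) Δ] at h3
    linarith
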